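/- Cut elimination for LS_BBI: if Γ ⊢ Δ is derivable in LS_BBI with the cut rule, then it is derivable in LS_BBI without any use of cut. -/

import Mathlib

/-- BBI formulas. -/
inductive BBIForm where
  | atom : ℕ → BBIForm
  | top : BBIForm
  | bot : BBIForm
  | emp : BBIForm               -- ⊤*
  | neg : BBIForm → BBIForm
  | conj : BBIForm → BBIForm → BBIForm
  | disj : BBIForm → BBIForm → BBIForm
  | imp : BBIForm → BBIForm → BBIForm
  | star : BBIForm → BBIForm → BBIForm
  | wand : BBIForm → BBIForm → BBIForm
deriving DecidableEq

/-- Labels: the constant ε together with label variables. -/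
inductive Label where
  | eps : Label
  | var : ℕ → Label
deriving DecidableEq

/-- A labelled formula w : A. -/
abbrev LForm := Label × BBIForm

/-- A relational atom (x, y ▷ z). -/
abbrev RAtom := Label × Label × Label

/-- An element of the antecedent: a relational atom or a labelled formula. -/
abbrev LElem := RAtom ⊕ LForm

/-- Substitution [y/x] on a single label. -/
def lsub (x y w : Label) : Label := if w = x then y else w

/-- Substitution [y/x] on an antecedent element. -/
def substElem (x y : Label) : LElem → LElem
  | Sum.inl (a, b, c) => Sum.inl (lsub x y a, lsub x y b, lsub x y c)
  | Sum.inr (a, A) => Sum.inr (lsub x y a, A)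

/-- Substitution [y/x] on an antecedent. -/
def substL (x y : Label) (Γ : Multiset LElem) : Multiset LElem :=
  Γ.map (substElem x y)

/-- Substitution [y/x] on a succedent. -/
def substR (x y : Label) (Δ : Multiset LForm) : Multiset LForm :=
  Δ.map (fun f => (lsub x y f.1, f.2))

/-- The labels occurring in an antecedent element. -/
def labelsOf : LElem → List Label
  | Sum.inl (a, b, c) => [a, b, c]
  | Sum.inr (a, _) => [a]

/-- A label is fresh for (does not occur in) a sequent. -/
def freshIn (w : Label) (Γ : Multiset LElem) (Δ : Multiset LForm) : Prop :=
  (∀ e ∈ Γ, w ∉ labelsOf e) ∧ (∀ f ∈ Δ, w ≠ f.1)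

/-- Shorthand for a relational atom in the antecedent. -/
def ra (x y z : Label) : LElem := Sum.inl (x, y, z)

/-- Shorthand for a labelled formula in the antecedent. -/
def lf (w : Label) (A : BBIForm) : LElem := Sum.inr (w, A)

/-- Derivability in the labelled sequent calculus LS_BBI for Boolean BI,
indexed by a flag allowing the cut rule, the sequent, and the height of the
derivation.  `Deriv false Γ Δ n` is derivability in the cut-free calculus
(rules id, ⊥L, ⊤R, ⊤*L, ⊤*R, ∧L, ∧R, →L, →R, ∗L, ∗R, −∗L, −∗R and the
structural rules E, A, U, A_C, Eq1, Eq2); `Deriv true Γ Δ n` additionally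
allows cut. -/
inductive Deriv : Bool → Multiset LElem → Multiset LForm → ℕ → Prop where
  | id (c : Bool) (Γ : Multiset LElem) (Δ : Multiset LForm) (w : Label) (p : ℕ) :
      Deriv c (lf w (BBIForm.atom p) ::ₘ Γ) ((w, BBIForm.atom p) ::ₘ Δ) 1
  | botL (c : Bool) (Γ : Multiset LElem) (Δ : Multiset LForm) (w : Label) :
      Deriv c (lf w BBIForm.bot ::ₘ Γ) Δ 1
  | topR (c : Bool) (Γ : Multiset LElem) (Δ : Multiset LForm) (w : Label) :
      Deriv c Γ ((w, BBIForm.top) ::ₘ Δ) 1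
  | empR (c : Bool) (Γ : Multiset LElem) (Δ : Multiset LForm) :
      Deriv c Γ ((Label.eps, BBIForm.emp) ::ₘ Δ) 1
  | empL {c Γ Δ n} (w : Label) : w ≠ Label.eps →
      Deriv c (substL w Label.eps Γ) (substR w Label.eps Δ) n →
      Deriv c (lf w BBIForm.emp ::ₘ Γ) Δ (n + 1)
  | conjL {c Γ Δ n} (w : Label) (A B : BBIForm) :
      Deriv c (lf w A ::ₘ lf w B ::ₘ Γ) Δ n →
      Deriv c (lf w (BBIForm.conj A B) ::ₘ Γ) Δ (n + 1)
  | conjR {c Γ Δ n m} (w : Label) (A B : BBIForm) :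
      Deriv c Γ ((w, A) ::ₘ Δ) n →
      Deriv c Γ ((w, B) ::ₘ Δ) m →
      Deriv c Γ ((w, BBIForm.conj A B) ::ₘ Δ) (max n m + 1)
  | impL {c Γ Δ n m} (w : Label) (A B : BBIForm) :
      Deriv c Γ ((w, A) ::ₘ Δ) n →
      Deriv c (lf w B ::ₘ Γ) Δ m →
      Deriv c (lf w (BBIForm.imp A B) ::ₘ Γ) Δ (max n m + 1)
  | impR {c Γ Δ n} (w : Label) (A B : BBIForm) :
      Deriv c (lf w A ::ₘ Γ) ((w, B) ::ₘ Δ) n →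
      Deriv c Γ ((w, BBIForm.imp A B) ::ₘ Δ) (n + 1)
  | starL {c Γ Δ n} (x y z : Label) (A B : BBIForm) :
      x ≠ Label.eps → y ≠ Label.eps → x ≠ y →
      freshIn x (lf z (BBIForm.star A B) ::ₘ Γ) Δ →
      freshIn y (lf z (BBIForm.star A B) ::ₘ Γ) Δ →
      Deriv c (ra x y z ::ₘ lf x A ::ₘ lf y B ::ₘ Γ) Δ n →
      Deriv c (lf z (BBIForm.star A B) ::ₘ Γ) Δ (n + 1)
  | starR {c Γ Δ n m} (x y z : Label) (A B : BBIForm) :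
      Deriv c (ra x y z ::ₘ Γ) ((x, A) ::ₘ (z, BBIForm.star A B) ::ₘ Δ) n →
      Deriv c (ra x y z ::ₘ Γ) ((y, B) ::ₘ (z, BBIForm.star A B) ::ₘ Δ) m →
      Deriv c (ra x y z ::ₘ Γ) ((z, BBIForm.star A B) ::ₘ Δ) (max n m + 1)
  | wandL {c Γ Δ n m} (x y z : Label) (A B : BBIForm) :
      Deriv c (ra x y z ::ₘ lf y (BBIForm.wand A B) ::ₘ Γ) ((x, A) ::ₘ Δ) n →
      Deriv c (ra x y z ::ₘ lf y (BBIForm.wand A B) ::ₘ lf z B ::ₘ Γ) Δ m →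
      Deriv c (ra x y z ::ₘ lf y (BBIForm.wand A B) ::ₘ Γ) Δ (max n m + 1)
  | wandR {c Γ Δ n} (x y z : Label) (A B : BBIForm) :
      x ≠ Label.eps → z ≠ Label.eps → x ≠ z →
      freshIn x Γ ((y, BBIForm.wand A B) ::ₘ Δ) →
      freshIn z Γ ((y, BBIForm.wand A B) ::ₘ Δ) →
      Deriv c (ra x y z ::ₘ lf x A ::ₘ Γ) ((z, B) ::ₘ Δ) n →
      Deriv c Γ ((y, BBIForm.wand A B) ::ₘ Δ) (n + 1)
  | exch {c Γ Δ n} (x y z : Label) :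
      Deriv c (ra y x z ::ₘ ra x y z ::ₘ Γ) Δ n →
      Deriv c (ra x y z ::ₘ Γ) Δ (n + 1)
  | assoc {c Γ Δ n} (x y z u v w : Label) :
      w ≠ Label.eps →
      freshIn w (ra x y z ::ₘ ra u v x ::ₘ Γ) Δ →
      Deriv c (ra u w z ::ₘ ra y v w ::ₘ ra x y z ::ₘ ra u v x ::ₘ Γ) Δ n →
      Deriv c (ra x y z ::ₘ ra u v x ::ₘ Γ) Δ (n + 1)
  | unit {c Γ Δ n} (x : Label) :
      Deriv c (ra x Label.eps x ::ₘ Γ) Δ n →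
      Deriv c Γ Δ (n + 1)
  | assocC {c Γ Δ n} (x y w : Label) :
      w ≠ Label.eps →
      freshIn w (ra x y x ::ₘ Γ) Δ →
      Deriv c (ra x w x ::ₘ ra y y w ::ₘ ra x y x ::ₘ Γ) Δ n →
      Deriv c (ra x y x ::ₘ Γ) Δ (n + 1)
  | eq1 {c Γ Δ n} (w w' : Label) :
      w ≠ Label.eps →
      Deriv c (ra Label.eps w' w' ::ₘ substL w w' Γ) (substR w w' Δ) n →
      Deriv c (ra Label.eps w w' ::ₘ Γ) Δ (n + 1)
  | eq2 {c Γ Δ n} (w w' : Label) :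
      w ≠ Label.eps →
      Deriv c (ra Label.eps w' w' ::ₘ substL w w' Γ) (substR w w' Δ) n →
      Deriv c (ra Label.eps w' w ::ₘ Γ) Δ (n + 1)
  | cut {Γ Γ' Δ Δ' n m} (x : Label) (A : BBIForm) :
      Deriv true Γ ((x, A) ::ₘ Δ) n →
      Deriv true (lf x A ::ₘ Γ') Δ' m →
      Deriv true (Γ + Γ') (Δ + Δ') (max n m + 1)


/-! A semantic proof: we evaluate derivations (with cut) in a Kripke-style model whose worlds are
sequents and whose absurd worlds are the cut-free derivable sequents. -/

namespace CutElim

abbrev Ctx := Multiset LElem × Multiset LForm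

def Goal (c : Ctx) : Prop := ∃ m, Deriv false c.1 c.2 m

/-- Membership of a labelled formula on the left (`true`) or right (`false`). -/
def mem (c : Ctx) (s : Bool) (A : BBIForm) (x : Label) : Prop :=
  if s then lf x A ∈ c.1 else (x, A) ∈ c.2

/-- A formula is covered if it is present or has been decomposed already. -/
def cov (c : Ctx) : BBIForm → Bool → Label → Prop
  | .conj A B, true, x => mem c true (.conj A B) x ∨ (cov c A true x ∧ cov c B true x)
  | .conj A B, false, x => mem c false (.conj A B) x ∨ (cov c A false x ∨ cov c B false x)
  | .imp A B, true, x => mem c true (.imp A B) x ∨ (cov c A false x ∨ cov c B true x)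
  | .imp A B, false, x => mem c false (.imp A B) x ∨ (cov c A true x ∧ cov c B false x)
  | .star A B, true, z => mem c true (.star A B) z ∨
      ∃ x y, ra x y z ∈ c.1 ∧ cov c A true x ∧ cov c B true y
  | .wand A B, false, y => mem c false (.wand A B) y ∨
      ∃ x z, ra x y z ∈ c.1 ∧ cov c A true x ∧ cov c B false z
  | .emp, true, x => mem c true .emp x ∨ x = Label.eps
  | A, s, x => mem c s A x

def CovE (τ : Label → Label) (c : Ctx) : LElem → Prop
  | Sum.inl (x, y, z) => ra (τ x) (τ y) (τ z) ∈ c.1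
  | Sum.inr (x, A) => cov c A true (τ x)

structure Le (τ : Label → Label) (c c' : Ctx) : Prop where
  eps : τ Label.eps = Label.eps
  left : ∀ e ∈ c.1, CovE τ c' e
  right : ∀ f ∈ c.2, cov c' f.2 false (τ f.1)

theorem cov_of_mem {c s A x} (h : mem c s A x) : cov c A s x := by
  cases A <;> cases s <;> simp only [cov] <;> first | exact h | exact Or.inl h

theorem Le.mem {τ c c'} (h : Le τ c c') {s A x} (hm : mem c s A x) : cov c' A s (τ x) := by
  cases s
  · exact h.right _ hm
  · exact h.left _ hm

theorem Le.ra {τ c c'} (h : Le τ c c') {x y z} (hm : ra x y z ∈ c.1) :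
    ra (τ x) (τ y) (τ z) ∈ c'.1 := h.left _ hm

theorem Le.cov {τ c c'} (h : Le τ c c') (A : BBIForm) :
    ∀ {s x}, cov c A s x → cov c' A s (τ x) := by
  induction A with
  | atom p => intro s x hx; simp only [CutElim.cov] at hx; exact h.mem hx
  | top => intro s x hx; simp only [CutElim.cov] at hx; exact h.mem hx
  | bot => intro s x hx; simp only [CutElim.cov] at hx; exact h.mem hx
  | neg A => intro s x hx; simp only [CutElim.cov] at hx; exact h.mem hx
  | disj A B => intro s x hx; simp only [CutElim.cov] at hx; exact h.mem hx
  | emp =>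
    intro s x hx
    cases s <;> simp only [CutElim.cov] at hx
    · exact h.mem hx
    · rcases hx with hx | rfl
      · exact h.mem hx
      · simp [CutElim.cov, h.eps]
  | conj A B ihA ihB =>
    intro s x hx
    cases s <;> simp only [CutElim.cov] at hx
    · rcases hx with hx | hx | hx
      · exact h.mem hx
      · simp [CutElim.cov, ihA hx]
      · simp [CutElim.cov, ihB hx]
    · rcases hx with hx | ⟨hx, hy⟩
      · exact h.mem hx
      · simp [CutElim.cov, ihA hx, ihB hy]
  | imp A B ihA ihB =>
    intro s x hx
    cases s <;> simp only [CutElim.cov] at hx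
    · rcases hx with hx | ⟨hx, hy⟩
      · exact h.mem hx
      · simp [CutElim.cov, ihA hx, ihB hy]
    · rcases hx with hx | hx | hx
      · exact h.mem hx
      · simp [CutElim.cov, ihA hx]
      · simp [CutElim.cov, ihB hx]
  | star A B ihA ihB =>
    intro s x hx
    cases s <;> simp only [CutElim.cov] at hx
    · exact h.mem hx
    · rcases hx with hx | ⟨a, b, hr, ha, hb⟩
      · exact h.mem hx
      · simp only [CutElim.cov]
        exact Or.inr ⟨_, _, h.ra hr, ihA ha, ihB hb⟩
  | wand A B ihA ihB =>
    intro s x hx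
    cases s <;> simp only [CutElim.cov] at hx
    · rcases hx with hx | ⟨a, b, hr, ha, hb⟩
      · exact h.mem hx
      · simp only [CutElim.cov]
        exact Or.inr ⟨_, _, h.ra hr, ihA ha, ihB hb⟩
    · exact h.mem hx

theorem Le.refl (c : Ctx) : Le (fun x => x) c c where
  eps := rfl
  left e he := by
    rcases e with ⟨x, y, z⟩ | ⟨x, A⟩
    · exact he
    · exact cov_of_mem (s := true) he
  right f hf := cov_of_mem (s := false) hf

theorem Le.trans {τ τ' c c' c''} (h : Le τ c c') (h' : Le τ' c' c'') :
    Le (fun x => τ' (τ x)) c c'' where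
  eps := by simp [h.eps, h'.eps]
  left e he := by
    have := h.left e he
    rcases e with ⟨x, y, z⟩ | ⟨x, A⟩
    · exact h'.ra this
    · exact h'.cov A this
  right f hf := h'.cov _ (h.right f hf)

abbrev Pr := Ctx → Label → Prop

def Neg (P : Pr) : Pr := fun c x => ∀ τ c', Le τ c c' → P c' (τ x) → Goal c'

def Q : BBIForm → Bool → Pr
  | .atom p, true => Neg (fun c x => lf x (.atom p) ∈ c.1)
  | .atom p, false => fun c x => lf x (.atom p) ∈ c.1
  | .top, true => fun _ _ => False
  | .top, false => fun _ _ => True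
  | .bot, true => fun _ _ => True
  | .bot, false => fun _ _ => False
  | .emp, true => Neg (fun _ x => x = Label.eps)
  | .emp, false => fun _ x => x = Label.eps
  | .neg _, _ => fun _ _ => False
  | .disj _ _, _ => fun _ _ => False
  | .conj A B, true => Neg (fun c x => Neg (Q A true) c x ∧ Neg (Q B true) c x)
  | .conj A B, false => Neg (fun c x => Neg (Q A false) c x ∨ Neg (Q B false) c x)
  | .imp A B, true => Neg (fun c x => Neg (Q A false) c x ∨ Neg (Q B true) c x)
  | .imp A B, false => Neg (fun c x => Neg (Q A true) c x ∧ Neg (Q B false) c x)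
  | .star A B, true => Neg (fun c z => ∃ x y, ra x y z ∈ c.1 ∧
      Neg (Q A true) c x ∧ Neg (Q B true) c y)
  | .star A B, false => fun c z => ∃ x y, ra x y z ∈ c.1 ∧
      Neg (Neg (Q A false)) c x ∧ Neg (Neg (Q B false)) c y
  | .wand A B, true => fun c y => ∃ x z, ra x y z ∈ c.1 ∧
      Neg (Neg (Q A false)) c x ∧ Neg (Neg (Q B true)) c z
  | .wand A B, false => Neg (fun c y => ∃ x z, ra x y z ∈ c.1 ∧
      Neg (Q A true) c x ∧ Neg (Q B false) c z)

def V (A : BBIForm) (s : Bool) : Pr := Neg (Q A s)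

theorem Neg.mono {P : Pr} {c c' τ x} (h : Neg P c x) (hl : Le τ c c') : Neg P c' (τ x) :=
  fun _ _ hl' hp => h _ _ (hl.trans hl') hp

theorem Neg.app {P : Pr} {c x} (h : Neg P c x) (hp : P c x) : Goal c :=
  h _ _ (Le.refl c) hp


def Mono (P : Pr) : Prop := ∀ {c x τ c'}, Le τ c c' → P c x → P c' (τ x)

theorem Neg.nn {P : Pr} (hP : Mono P) {c x} (h : P c x) : Neg (Neg P) c x :=
  fun _ _ hl hn => hn.app (hP hl h)

theorem Neg.imp {P P' : Pr} {c x} (h : Neg P c x) (hi : ∀ {c x}, P' c x → P c x) :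
    Neg P' c x := fun _ _ hl hp => h _ _ hl (hi hp)

theorem mono_and {P P' : Pr} : Mono (fun c x => Neg P c x ∧ Neg P' c x) :=
  fun hl h => ⟨h.1.mono hl, h.2.mono hl⟩

theorem mono_or {P P' : Pr} : Mono (fun c x => Neg P c x ∨ Neg P' c x) :=
  fun hl h => h.imp (fun h => h.mono hl) (fun h => h.mono hl)

theorem mono_star {P P' : Pr} :
    Mono (fun c z => ∃ x y, ra x y z ∈ c.1 ∧ Neg P c x ∧ Neg P' c y) :=
  fun hl ⟨_, _, h, h1, h2⟩ => ⟨_, _, hl.ra h, h1.mono hl, h2.mono hl⟩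

theorem mono_wand {P P' : Pr} :
    Mono (fun c y => ∃ x z, ra x y z ∈ c.1 ∧ Neg P c x ∧ Neg P' c z) :=
  fun hl ⟨_, _, h, h1, h2⟩ => ⟨_, _, hl.ra h, h1.mono hl, h2.mono hl⟩

theorem mono_atom {p : ℕ} : Mono (fun c x => lf x (.atom p) ∈ c.1) := by
  intro c x τ c' hl h
  have := hl.mem (s := true) h
  simpa [cov, mem] using this

theorem mono_eps : Mono (fun _ x => x = Label.eps) := by
  rintro c x τ c' hl rfl
  exact hl.eps

/-- The two values of a formula are dual. -/
theorem dual (A : BBIForm) : ∀ s {c x}, Neg (V A s) c x → V A (!s) c x := by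
  induction A with
  | atom p =>
    rintro (_ | _) c x h τ c' hl hq
    · exact (h.mono hl).app hq
    · exact (h.mono hl).app (Neg.nn mono_atom hq)
  | emp =>
    rintro (_ | _) c x h τ c' hl hq
    · exact (h.mono hl).app hq
    · exact (h.mono hl).app (Neg.nn mono_eps hq)
  | top =>
    rintro (_ | _) c x h τ c' hl hq
    · exact hq.elim
    · exact (h.mono hl).app (fun _ _ _ hf => hf.elim)
  | bot =>
    rintro (_ | _) c x h τ c' hl hq
    · exact (h.mono hl).app (fun _ _ _ hf => hf.elim)
    · exact hq.elim
  | neg A => rintro (_ | _) c x h τ c' hl hq <;> exact hq.elim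
  | disj A => rintro (_ | _) c x h τ c' hl hq <;> exact hq.elim
  | conj A B ihA ihB =>
    rintro (_ | _) c x h τ c' hl hq
    · have h1 := h.mono hl
      refine hq.app ⟨ihA false fun τ c' hl hp => ?_, ihB false fun τ c' hl hp => ?_⟩
      · exact (h1.mono hl).app (Neg.nn mono_or (Or.inl hp))
      · exact (h1.mono hl).app (Neg.nn mono_or (Or.inr hp))
    · refine (h.mono hl).app (Neg.nn mono_and ⟨?_, ?_⟩)
      · exact ihA false (hq.imp Or.inl)
      · exact ihB false (hq.imp Or.inr)
  | imp A B ihA ihB =>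
    rintro (_ | _) c x h τ c' hl hq
    · refine (h.mono hl).app (Neg.nn mono_and ⟨?_, ?_⟩)
      · exact ihA false (hq.imp Or.inl)
      · exact ihB true (hq.imp Or.inr)
    · have h1 := h.mono hl
      refine hq.app ⟨ihA false fun τ c' hl hp => ?_, ihB true fun τ c' hl hp => ?_⟩
      · exact (h1.mono hl).app (Neg.nn mono_or (Or.inl hp))
      · exact (h1.mono hl).app (Neg.nn mono_or (Or.inr hp))
  | star A B ihA ihB =>
    rintro (_ | _) c x h τ c' hl hq
    · refine (h.mono hl).app ?_
      rintro τ c' hl ⟨a, b, hr, ha, hb⟩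
      exact (hq.mono hl).app ⟨a, b, hr, ihA false ha, ihB false hb⟩
    · obtain ⟨a, b, hr, ha, hb⟩ := hq
      exact (h.mono hl).app (Neg.nn mono_star ⟨a, b, hr, ihA false ha, ihB false hb⟩)
  | wand A B ihA ihB =>
    rintro (_ | _) c x h τ c' hl hq
    · obtain ⟨a, b, hr, ha, hb⟩ := hq
      exact (h.mono hl).app (Neg.nn mono_wand ⟨a, b, hr, ihA false ha, ihB true hb⟩)
    · refine (h.mono hl).app ?_
      rintro τ c' hl ⟨a, b, hr, ha, hb⟩
      exact (hq.mono hl).app ⟨a, b, hr, ihA false ha, ihB true hb⟩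

theorem covE_of_mem {c : Ctx} {e : LElem} (h : e ∈ c.1) : CovE (fun x => x) c e := by
  rcases e with ⟨x, y, z⟩ | ⟨x, A⟩
  · exact h
  · exact cov_of_mem (s := true) h

theorem le_sub {Γ Δ Γ' Δ'} (h : Γ ⊆ Γ') (h' : Δ ⊆ Δ') :
    Le (fun x => x) (Γ, Δ) (Γ', Δ') where
  eps := rfl
  left e he := covE_of_mem (h he)
  right f hf := cov_of_mem (s := false) (h' hf)

theorem le_consL {e Γ Δ Γ' Δ'} (he : CovE (fun x => x) (Γ', Δ') e) (h : Γ ⊆ Γ') (h' : Δ ⊆ Δ') :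
    Le (fun x => x) (e ::ₘ Γ, Δ) (Γ', Δ') where
  eps := rfl
  left _ he := by
    rcases Multiset.mem_cons.1 he with rfl | he
    · assumption
    · exact covE_of_mem (h he)
  right f hf := cov_of_mem (s := false) (h' hf)

theorem le_consR {f : LForm} {Γ Δ Γ' Δ'} (he : cov (Γ', Δ') f.2 false f.1) (h : Γ ⊆ Γ')
    (h' : Δ ⊆ Δ') : Le (fun x => x) (Γ, f ::ₘ Δ) (Γ', Δ') where
  eps := rfl
  left e he := covE_of_mem (h he)
  right f hf := by
    rcases Multiset.mem_cons.1 hf with rfl | hf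
    · assumption
    · exact cov_of_mem (s := false) (h' hf)

theorem le_subst {w w' : Label} {e Γ Δ Γ'} (hw : w ≠ Label.eps)
    (he : CovE (lsub w w') (Γ', substR w w' Δ) e) (h : substL w w' Γ ⊆ Γ') :
    Le (lsub w w') (e ::ₘ Γ, Δ) (Γ', substR w w' Δ) where
  eps := by simp [lsub, hw.symm]
  left e he := by
    rcases Multiset.mem_cons.1 he with rfl | he
    · assumption
    · have := h (Multiset.mem_map_of_mem (substElem w w') he)
      rcases e with ⟨x, y, z⟩ | ⟨x, A⟩
      · exact this
      · exact cov_of_mem (s := true) this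
  right f hf := cov_of_mem (s := false)
    (Multiset.mem_map_of_mem (fun f : LForm => (lsub w w' f.1, f.2)) hf)

theorem exists_fresh (Γ : Multiset LElem) (Δ : Multiset LForm) (v : Label) :
    ∃ w, w ≠ Label.eps ∧ w ≠ v ∧ freshIn w Γ Δ := by
  have : Infinite Label := Infinite.of_injective Label.var (fun a b h => by simpa using h)
  obtain ⟨w, hw⟩ := Infinite.exists_notMem_finset
    ({Label.eps, v} ∪ Γ.toFinset.biUnion (fun e => (labelsOf e).toFinset) ∪
      Δ.toFinset.image Prod.fst)
  simp only [Finset.mem_union, Finset.mem_insert, Finset.mem_singleton, Finset.mem_biUnion,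
    Finset.mem_image, Multiset.mem_toFinset, List.mem_toFinset, not_or, not_exists, not_and] at hw
  exact ⟨w, hw.1.1.1, hw.1.1.2, fun e he => hw.1.2 e he, fun f hf h => hw.2 f hf h.symm⟩

/-- Adding elements on either side goes up. -/
theorem le_addL {Γ Δ} (Γ₀ : Multiset LElem) : Le (fun x => x) (Γ, Δ) (Γ₀ + Γ, Δ) :=
  le_sub (Multiset.subset_of_le (Multiset.le_add_left _ _)) (Multiset.Subset.refl _)

theorem le_addR {Γ : Multiset LElem} {Δ} (f : LForm) : Le (fun x => x) (Γ, Δ) (Γ, f ::ₘ Δ) :=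
  le_sub (Multiset.Subset.refl _) (Multiset.subset_cons _ _)

theorem V_of_key {A : BBIForm} {s} (h : ∀ {c x}, cov c A s x → Q A s c x → Goal c) {c x}
    (hc : cov c A s x) : V A s c x := fun _ _ hl hq => h (hl.cov A hc) hq

theorem cov_headL {x A Γ Δ} : cov (lf x A ::ₘ Γ, Δ) A true x :=
  cov_of_mem (Multiset.mem_cons_self _ _)

theorem cov_headR {x A Γ Δ} : cov (Γ, (x, A) ::ₘ Δ) A false x :=
  cov_of_mem (Multiset.mem_cons_self _ _)

theorem key (A : BBIForm) : ∀ s {c x}, cov c A s x → Q A s c x → Goal c := by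
  induction A with
  | atom p =>
    rintro (_ | _) c x h hq
    · obtain ⟨Γ, hΓ⟩ := Multiset.exists_cons_of_mem (show lf x (.atom p) ∈ c.1 from hq)
      obtain ⟨Δ, hΔ⟩ := Multiset.exists_cons_of_mem (show (x, BBIForm.atom p) ∈ c.2 from h)
      refine ⟨1, ?_⟩
      rw [hΓ, hΔ]
      exact .id _ _ _ _ _
    · exact Neg.app hq h
  | emp =>
    rintro (_ | _) c x h hq
    · obtain ⟨Δ, hΔ⟩ := Multiset.exists_cons_of_mem (show (x, BBIForm.emp) ∈ c.2 from h)
      have hx : x = Label.eps := hq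
      refine ⟨1, ?_⟩
      rw [hΔ, hx]
      exact .empR _ _ _
    · by_cases hx : x = Label.eps
      · exact Neg.app hq hx
      · simp only [cov, hx, or_false] at h
        obtain ⟨Γ, Δ⟩ := c
        obtain ⟨Γ, rfl⟩ := Multiset.exists_cons_of_mem (show lf x .emp ∈ Γ from h)
        have hl : Le (lsub x Label.eps) (lf x .emp ::ₘ Γ, Δ)
            (substL x Label.eps Γ, substR x Label.eps Δ) :=
          le_subst hx (by simp [CovE, lf, cov, lsub]) (Multiset.Subset.refl _)
        obtain ⟨m, hm⟩ := hq _ _ hl (by simp [lsub])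
        exact ⟨_, .empL x hx hm⟩
  | top =>
    rintro (_ | _) c x h hq
    · obtain ⟨Δ, hΔ⟩ := Multiset.exists_cons_of_mem (show (x, BBIForm.top) ∈ c.2 from h)
      refine ⟨1, ?_⟩
      rw [hΔ]
      exact .topR _ _ _ _
    · exact hq.elim
  | bot =>
    rintro (_ | _) c x h hq
    · exact hq.elim
    · obtain ⟨Γ, hΓ⟩ := Multiset.exists_cons_of_mem (show lf x .bot ∈ c.1 from h)
      refine ⟨1, ?_⟩
      rw [hΓ]
      exact .botL _ _ _ _
  | neg A => rintro (_ | _) c x h hq <;> exact hq.elim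
  | disj A => rintro (_ | _) c x h hq <;> exact hq.elim
  | conj A B ihA ihB =>
    rintro (_ | _) ⟨Γ, Δ⟩ x h hq <;> simp only [cov] at h
    · rcases h with h | h | h
      · obtain ⟨Δ, rfl⟩ := Multiset.exists_cons_of_mem (show (x, BBIForm.conj A B) ∈ Δ from h)
        have h1 : Le (fun x => x) (Γ, (x, BBIForm.conj A B) ::ₘ Δ) (Γ, (x, A) ::ₘ Δ) :=
          le_consR (by simp [cov, cov_headR]) (fun e he => by simp [he])
            (fun e he => by simp [he])
        have h2 : Le (fun x => x) (Γ, (x, BBIForm.conj A B) ::ₘ Δ) (Γ, (x, B) ::ₘ Δ) :=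
          le_consR (by simp [cov, cov_headR]) (fun e he => by simp [he])
            (fun e he => by simp [he])
        obtain ⟨m, hm⟩ := hq _ _ h1 (Or.inl (V_of_key (ihA false) cov_headR))
        obtain ⟨n, hn⟩ := hq _ _ h2 (Or.inr (V_of_key (ihB false) cov_headR))
        exact ⟨_, .conjR x A B hm hn⟩
      · exact Neg.app hq (Or.inl (V_of_key (ihA false) h))
      · exact Neg.app hq (Or.inr (V_of_key (ihB false) h))
    · rcases h with h | ⟨ha, hb⟩
      · obtain ⟨Γ, rfl⟩ := Multiset.exists_cons_of_mem (show lf x (.conj A B) ∈ Γ from h)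
        have hB : cov (lf x A ::ₘ lf x B ::ₘ Γ, Δ) B true x :=
          cov_of_mem (by simp [mem])
        have h1 : Le (fun x => x) (lf x (.conj A B) ::ₘ Γ, Δ) (lf x A ::ₘ lf x B ::ₘ Γ, Δ) :=
          le_consL (by simp [lf, CovE, cov]; exact Or.inr ⟨cov_headL, hB⟩)
            (fun e he => by simp [he])
            (fun e he => by simp [he])
        obtain ⟨m, hm⟩ := hq _ _ h1
          ⟨V_of_key (ihA true) cov_headL, V_of_key (ihB true) hB⟩
        exact ⟨_, .conjL x A B hm⟩
      · exact Neg.app hq ⟨V_of_key (ihA true) ha, V_of_key (ihB true) hb⟩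
  | imp A B ihA ihB =>
    rintro (_ | _) ⟨Γ, Δ⟩ x h hq <;> simp only [cov] at h
    · rcases h with h | ⟨ha, hb⟩
      · obtain ⟨Δ, rfl⟩ := Multiset.exists_cons_of_mem (show (x, BBIForm.imp A B) ∈ Δ from h)
        have h1 : Le (fun x => x) (Γ, (x, BBIForm.imp A B) ::ₘ Δ) (lf x A ::ₘ Γ, (x, B) ::ₘ Δ) :=
          le_consR (by simp [cov, cov_headR, cov_headL]) (fun e he => by simp [he])
            (fun e he => by simp [he])
        obtain ⟨m, hm⟩ := hq _ _ h1
          ⟨V_of_key (ihA true) cov_headL, V_of_key (ihB false) cov_headR⟩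
        exact ⟨_, .impR x A B hm⟩
      · exact Neg.app hq ⟨V_of_key (ihA true) ha, V_of_key (ihB false) hb⟩
    · rcases h with h | h | h
      · obtain ⟨Γ, rfl⟩ := Multiset.exists_cons_of_mem (show lf x (.imp A B) ∈ Γ from h)
        have h1 : Le (fun x => x) (lf x (.imp A B) ::ₘ Γ, Δ) (Γ, (x, A) ::ₘ Δ) :=
          le_consL (by simp [lf, CovE, cov, cov_headR]) (fun e he => by simp [he])
            (fun e he => by simp [he])
        have h2 : Le (fun x => x) (lf x (.imp A B) ::ₘ Γ, Δ) (lf x B ::ₘ Γ, Δ) :=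
          le_consL (by simp [lf, CovE, cov]; exact Or.inr (Or.inr cov_headL)) (fun e he => by simp [he])
            (fun e he => by simp [he])
        obtain ⟨m, hm⟩ := hq _ _ h1 (Or.inl (V_of_key (ihA false) cov_headR))
        obtain ⟨n, hn⟩ := hq _ _ h2 (Or.inr (V_of_key (ihB true) cov_headL))
        exact ⟨_, .impL x A B hm hn⟩
      · exact Neg.app hq (Or.inl (V_of_key (ihA false) h))
      · exact Neg.app hq (Or.inr (V_of_key (ihB true) h))
  | star A B ihA ihB =>
    rintro (_ | _) ⟨Γ, Δ⟩ z h hq <;> simp only [cov] at h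
    · obtain ⟨Δ, rfl⟩ := Multiset.exists_cons_of_mem (show (z, BBIForm.star A B) ∈ Δ from h)
      obtain ⟨x, y, hr, ha, hb⟩ := hq
      obtain ⟨Γ, rfl⟩ := Multiset.exists_cons_of_mem (show ra x y z ∈ Γ from hr)
      obtain ⟨m, hm⟩ := ha _ _ (le_addR (x, A)) (V_of_key (ihA false) cov_headR)
      obtain ⟨n, hn⟩ := hb _ _ (le_addR (y, B)) (V_of_key (ihB false) cov_headR)
      exact ⟨_, .starR x y z A B hm hn⟩
    · rcases h with h | ⟨a, b, hr, ha, hb⟩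
      · obtain ⟨Γ, rfl⟩ := Multiset.exists_cons_of_mem (show lf z (.star A B) ∈ Γ from h)
        obtain ⟨x, hx, -, fx⟩ := exists_fresh (lf z (.star A B) ::ₘ Γ) Δ Label.eps
        obtain ⟨y, hy, hyx, fy⟩ := exists_fresh (lf z (.star A B) ::ₘ Γ) Δ x
        have hA : cov (ra x y z ::ₘ lf x A ::ₘ lf y B ::ₘ Γ, Δ) A true x :=
          cov_of_mem (by simp [mem])
        have hB : cov (ra x y z ::ₘ lf x A ::ₘ lf y B ::ₘ Γ, Δ) B true y :=
          cov_of_mem (by simp [mem])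
        have h1 : Le (fun x => x) (lf z (.star A B) ::ₘ Γ, Δ)
            (ra x y z ::ₘ lf x A ::ₘ lf y B ::ₘ Γ, Δ) :=
          le_consL (Or.inr ⟨x, y, Multiset.mem_cons_self _ _, hA, hB⟩)
            (fun e he => by simp [he])
            (fun e he => by simp [he])
        obtain ⟨m, hm⟩ := hq _ _ h1 ⟨x, y, Multiset.mem_cons_self _ _,
          V_of_key (ihA true) hA, V_of_key (ihB true) hB⟩
        exact ⟨_, .starL x y z A B hx hy hyx.symm fx fy hm⟩
      · exact Neg.app hq ⟨a, b, hr, V_of_key (ihA true) ha, V_of_key (ihB true) hb⟩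
  | wand A B ihA ihB =>
    rintro (_ | _) ⟨Γ, Δ⟩ y h hq <;> simp only [cov] at h
    · rcases h with h | ⟨a, b, hr, ha, hb⟩
      · obtain ⟨Δ, rfl⟩ := Multiset.exists_cons_of_mem (show (y, BBIForm.wand A B) ∈ Δ from h)
        obtain ⟨x, hx, -, fx⟩ := exists_fresh Γ ((y, BBIForm.wand A B) ::ₘ Δ) Label.eps
        obtain ⟨z, hz, hzx, fz⟩ := exists_fresh Γ ((y, BBIForm.wand A B) ::ₘ Δ) x
        have hA : cov (ra x y z ::ₘ lf x A ::ₘ Γ, (z, B) ::ₘ Δ) A true x :=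
          cov_of_mem (by simp [mem])
        have h1 : Le (fun x => x) (Γ, (y, BBIForm.wand A B) ::ₘ Δ)
            (ra x y z ::ₘ lf x A ::ₘ Γ, (z, B) ::ₘ Δ) :=
          le_consR (Or.inr ⟨x, z, Multiset.mem_cons_self _ _, hA, cov_headR⟩)
            (fun e he => by simp [he])
            (fun e he => by simp [he])
        obtain ⟨m, hm⟩ := hq _ _ h1 ⟨x, z, Multiset.mem_cons_self _ _,
          V_of_key (ihA true) hA, V_of_key (ihB false) cov_headR⟩
        exact ⟨_, .wandR x y z A B hx hz hzx.symm fx fz hm⟩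
      · exact Neg.app hq ⟨a, b, hr, V_of_key (ihA true) ha, V_of_key (ihB false) hb⟩
    · obtain ⟨x, z, hr, ha, hb⟩ := hq
      obtain ⟨Γ, rfl⟩ := Multiset.exists_cons_of_mem (show ra x y z ∈ Γ from hr)
      have h' : lf y (.wand A B) ∈ Γ := by
        have h' : lf y (.wand A B) ∈ ra x y z ::ₘ Γ := h
        simpa [lf, ra] using h'
      obtain ⟨Γ, rfl⟩ := Multiset.exists_cons_of_mem h'
      have hB : cov (ra x y z ::ₘ lf y (.wand A B) ::ₘ lf z B ::ₘ Γ, Δ) B true z :=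
        cov_of_mem (by simp [mem])
      have h2 : Le (fun x => x) (ra x y z ::ₘ lf y (.wand A B) ::ₘ Γ, Δ)
          (ra x y z ::ₘ lf y (.wand A B) ::ₘ lf z B ::ₘ Γ, Δ) :=
        le_sub (fun e he => by simp at he ⊢; tauto) (by simp)
      obtain ⟨m, hm⟩ := ha _ _ (le_addR (x, A)) (V_of_key (ihA false) cov_headR)
      obtain ⟨n, hn⟩ := hb _ _ h2 (V_of_key (ihB true) hB)
      exact ⟨_, .wandL x y z A B hm hn⟩

/-! Soundness of the calculus with cut in the model. -/

def SatE (σ : Label → Label) (c : Ctx) : LElem → Prop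
  | Sum.inl (x, y, z) => ra (σ x) (σ y) (σ z) ∈ c.1
  | Sum.inr (x, A) => V A true c (σ x)

def SatF (σ : Label → Label) (c : Ctx) (f : LForm) : Prop := V f.2 false c (σ f.1)

structure Sat (σ : Label → Label) (c : Ctx) (Γ : Multiset LElem) (Δ : Multiset LForm) : Prop where
  eps : σ Label.eps = Label.eps
  left : ∀ e ∈ Γ, SatE σ c e
  right : ∀ f ∈ Δ, SatF σ c f

theorem Sat.mono {σ c Γ Δ} (h : Sat σ c Γ Δ) {τ c'} (hl : Le τ c c') :
    Sat (fun x => τ (σ x)) c' Γ Δ where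
  eps := by simp [h.eps, hl.eps]
  left e he := by
    have := h.left e he
    rcases e with ⟨x, y, z⟩ | ⟨x, A⟩
    · exact hl.ra this
    · exact Neg.mono this hl
  right f hf := Neg.mono (h.right f hf) hl

theorem Sat.consL {σ c Γ Δ e} (h : Sat σ c Γ Δ) (he : SatE σ c e) : Sat σ c (e ::ₘ Γ) Δ :=
  ⟨h.eps, fun e' h' => by
    rcases Multiset.mem_cons.1 h' with rfl | h'
    · exact he
    · exact h.left _ h', h.right⟩

theorem Sat.consR {σ c Γ Δ f} (h : Sat σ c Γ Δ) (hf : SatF σ c f) : Sat σ c Γ (f ::ₘ Δ) :=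
  ⟨h.eps, h.left, fun e' h' => by
    rcases Multiset.mem_cons.1 h' with rfl | h'
    · exact hf
    · exact h.right _ h'⟩

theorem Sat.sub {σ c Γ Δ Γ' Δ'} (h : Sat σ c Γ Δ) (h1 : Γ' ⊆ Γ) (h2 : Δ' ⊆ Δ) :
    Sat σ c Γ' Δ' := ⟨h.eps, fun e he => h.left e (h1 he), fun f hf => h.right f (h2 hf)⟩

theorem Sat.tailL {σ c Γ Δ e} (h : Sat σ c (e ::ₘ Γ) Δ) : Sat σ c Γ Δ :=
  h.sub (Multiset.subset_cons _ _) (Multiset.Subset.refl _)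

theorem Sat.tailR {σ c Γ Δ f} (h : Sat σ c Γ (f ::ₘ Δ)) : Sat σ c Γ Δ :=
  h.sub (Multiset.Subset.refl _) (Multiset.subset_cons _ _)

theorem Sat.headL {σ c Γ Δ e} (h : Sat σ c (e ::ₘ Γ) Δ) : SatE σ c e :=
  h.left _ (Multiset.mem_cons_self _ _)

theorem Sat.headR {σ c Γ Δ f} (h : Sat σ c Γ (f ::ₘ Δ)) : SatF σ c f :=
  h.right _ (Multiset.mem_cons_self _ _)

/-- Changing the assignment at a fresh label. -/
theorem Sat.update {σ c Γ Δ} (h : Sat σ c Γ Δ) {w : Label} (a : Label) (hw : w ≠ Label.eps)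
    (hf : freshIn w Γ Δ) : Sat (Function.update σ w a) c Γ Δ where
  eps := by simp [Function.update, hw.symm, h.eps]
  left e he := by
    have h1 := h.left e he
    have h2 := hf.1 e he
    rcases e with ⟨x, y, z⟩ | ⟨x, A⟩
    · simp only [labelsOf, List.mem_cons, List.not_mem_nil, or_false, not_or] at h2
      simpa [SatE, Function.update, Ne.symm h2.1, Ne.symm h2.2.1, Ne.symm h2.2.2,
        eq_comm (b := w), h2.1, h2.2.1, h2.2.2] using h1
    · simp only [labelsOf, List.mem_cons, List.not_mem_nil, or_false] at h2
      simpa [SatE, Function.update, eq_comm (b := w), h2] using h1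
  right f hf' := by
    have h1 := h.right f hf'
    have h2 := hf.2 f hf'
    simpa [SatF, Function.update, eq_comm (b := w), h2] using h1

theorem Sat.subst {σ c Γ Δ} (h : Sat σ c Γ Δ) {w w' : Label} (hw : σ w = σ w') :
    Sat σ c (substL w w' Γ) (substR w w' Δ) where
  eps := h.eps
  left e he := by
    have hs : ∀ a, σ (lsub w w' a) = σ a := by
      intro a; unfold lsub; split_ifs with h
      · rw [h, hw]
      · rfl
    obtain ⟨e, he', rfl⟩ := Multiset.mem_map.1 he
    have h1 := h.left e he'
    rcases e with ⟨x, y, z⟩ | ⟨x, A⟩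
    · simpa [SatE, substElem, hs] using h1
    · simpa [SatE, substElem, hs] using h1
  right f hf := by
    have hs : ∀ a, σ (lsub w w' a) = σ a := by
      intro a; unfold lsub; split_ifs with h
      · rw [h, hw]
      · rfl
    obtain ⟨f, hf', rfl⟩ := Multiset.mem_map.1 hf
    have h1 := h.right f hf'
    simpa [SatF, hs] using h1

/-- The equality rules of the target, in the form needed for soundness. -/
theorem goal_eq {c : Ctx} {a b : Label} (h : ra Label.eps a b ∈ c.1)
    (k : ∀ τ c', Le τ c c' → τ a = τ b → Goal c') : Goal c := by
  obtain ⟨Γ, Δ⟩ := c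
  obtain ⟨Γ, rfl⟩ := Multiset.exists_cons_of_mem (show ra Label.eps a b ∈ Γ from h)
  by_cases ha : a = Label.eps
  · by_cases hb : b = Label.eps
    · exact k _ _ (Le.refl _) (by simp [ha, hb])
    · have hl : Le (lsub b a) (ra Label.eps a b ::ₘ Γ, Δ)
          (ra Label.eps a a ::ₘ substL b a Γ, substR b a Δ) :=
        le_subst hb (by simp [ra, CovE, lsub, Ne.symm hb]) (Multiset.subset_cons _ _)
      obtain ⟨m, hm⟩ := k _ _ hl (by simp [lsub])
      exact ⟨_, .eq2 b a hb hm⟩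
  · have hl : Le (lsub a b) (ra Label.eps a b ::ₘ Γ, Δ)
        (ra Label.eps b b ::ₘ substL a b Γ, substR a b Δ) :=
      le_subst ha (by simp [ra, CovE, lsub, Ne.symm ha]) (Multiset.subset_cons _ _)
    obtain ⟨m, hm⟩ := k _ _ hl (by simp [lsub])
    exact ⟨_, .eq1 a b ha hm⟩

theorem goal_assoc {c : Ctx} {x y z u v : Label} (h1 : ra x y z ∈ c.1) (h2 : ra u v x ∈ c.1)
    (k : ∀ w c', Le (fun x => x) c c' → ra u w z ∈ c'.1 → ra y v w ∈ c'.1 → Goal c') :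
    Goal c := by
  obtain ⟨Γ, Δ⟩ := c
  obtain ⟨Γ, rfl⟩ := Multiset.exists_cons_of_mem (show ra x y z ∈ Γ from h1)
  obtain ⟨w, hw, -, fw⟩ := exists_fresh (ra x y z ::ₘ Γ) Δ Label.eps
  have hl : Le (fun x => x) (ra x y z ::ₘ Γ, Δ)
      (ra u w z ::ₘ ra y v w ::ₘ ra x y z ::ₘ Γ, Δ) :=
    le_sub (fun e he => by simp at he ⊢; tauto) (by simp)
  obtain ⟨m, hm⟩ := k w _ hl (by simp) (by simp)
  rcases Multiset.mem_cons.1 h2 with h2 | h2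
  · simp only [ra, Sum.inl.injEq, Prod.mk.injEq] at h2
    obtain ⟨rfl, rfl, rfl⟩ := h2
    exact ⟨_, .assocC _ _ w hw fw hm⟩
  · obtain ⟨Γ, rfl⟩ := Multiset.exists_cons_of_mem h2
    exact ⟨_, .assoc x y z u v w hw fw hm⟩

theorem sound {b Γ Δ n} (h : Deriv b Γ Δ n) : ∀ {σ c}, Sat σ c Γ Δ → Goal c := by
  induction h with
  | id b Γ Δ w p =>
    intro σ c h
    exact Neg.app (P := Q (.atom p) true) h.headL h.headR
  | botL b Γ Δ w =>
    intro σ c h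
    exact Neg.app (P := Q .bot true) h.headL trivial
  | topR b Γ Δ w =>
    intro σ c h
    exact Neg.app (P := Q .top false) h.headR trivial
  | empR b Γ Δ =>
    intro σ c h
    exact Neg.app (P := Q .emp false) h.headR h.eps
  | empL w hw _ ih =>
    intro σ c h
    refine Neg.app (P := Q .emp true) h.headL fun τ c' hl hx => ?_
    have h' := h.tailL.mono hl
    exact ih (h'.subst (hx.trans h'.eps.symm))
  | conjL w A B _ ih =>
    intro σ c h
    refine Neg.app (P := Q (.conj A B) true) h.headL fun τ c' hl hx => ?_
    exact ih (((h.tailL.mono hl).consL (e := lf w B) hx.2).consL (e := lf w A) hx.1)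
  | conjR w A B _ _ ih1 ih2 =>
    intro σ c h
    refine Neg.app (P := Q (.conj A B) false) h.headR fun τ c' hl hx => ?_
    rcases hx with hx | hx
    · exact ih1 ((h.tailR.mono hl).consR hx)
    · exact ih2 ((h.tailR.mono hl).consR hx)
  | impL w A B _ _ ih1 ih2 =>
    intro σ c h
    refine Neg.app (P := Q (.imp A B) true) h.headL fun τ c' hl hx => ?_
    rcases hx with hx | hx
    · exact ih1 ((h.tailL.mono hl).consR hx)
    · exact ih2 ((h.tailL.mono hl).consL hx)
  | impR w A B _ ih =>
    intro σ c h
    refine Neg.app (P := Q (.imp A B) false) h.headR fun τ c' hl hx => ?_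
    exact ih (((h.tailR.mono hl).consR (f := (w, B)) hx.2).consL (e := lf w A) hx.1)
  | starL x y z A B hx hy hxy fx fy _ ih =>
    intro σ c h
    refine Neg.app (P := Q (.star A B) true) h.headL fun τ c' hl hq => ?_
    obtain ⟨a, b, hr, ha, hb⟩ := hq
    have h' := ((h.mono hl).update a hx fx).update b hy fy
    have hzx : z ≠ x := fun e => fx.1 _ (Multiset.mem_cons_self _ _) (by simp [lf, labelsOf, e])
    have hzy : z ≠ y := fun e => fy.1 _ (Multiset.mem_cons_self _ _) (by simp [lf, labelsOf, e])
    refine ih (((h'.tailL.consL ?_).consL ?_).consL ?_)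
    · simpa [SatE, V, lf] using hb
    · simpa [SatE, V, lf, Function.update, hxy] using ha
    · simpa [SatE, ra, Function.update, hxy, hzx, hzy] using hr
  | starR x y z A B _ _ ih1 ih2 =>
    intro σ c h
    refine Neg.app (P := Q (.star A B) false) h.headR ⟨σ x, σ y, h.headL, ?_, ?_⟩
    · exact fun τ c' hl hx => ih1 ((h.mono hl).consR hx)
    · exact fun τ c' hl hx => ih2 ((h.mono hl).consR hx)
  | wandL x y z A B _ _ ih1 ih2 =>
    intro σ c h
    refine Neg.app (P := Q (.wand A B) true) h.tailL.headL ⟨σ x, σ z, h.headL, ?_, ?_⟩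
    · exact fun τ c' hl hx => ih1 ((h.mono hl).consR hx)
    · exact fun τ c' hl hx => ih2 (((h.mono hl).consL (e := lf z B) hx).sub
        (fun e he => by simp at he ⊢; tauto) (by simp))
  | wandR x y z A B hx hz hxz fx fz _ ih =>
    intro σ c h
    refine Neg.app (P := Q (.wand A B) false) h.headR fun τ c' hl hq => ?_
    obtain ⟨a, b, hr, ha, hb⟩ := hq
    have h' := ((h.mono hl).update a hx fx).update b hz fz
    have hyx : y ≠ x := fun e => fx.2 _ (Multiset.mem_cons_self _ _) (by simp [e])
    have hyz : y ≠ z := fun e => fz.2 _ (Multiset.mem_cons_self _ _) (by simp [e])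
    refine ih (((h'.tailR.consR ?_).consL ?_).consL ?_)
    · simpa [SatF, V] using hb
    · simpa [SatE, V, lf, Function.update, hxz] using ha
    · simpa [SatE, ra, Function.update, hxz, hyx, hyz] using hr
  | exch x y z _ ih =>
    rintro σ ⟨Γ, Δ⟩ h
    obtain ⟨Γ, rfl⟩ := Multiset.exists_cons_of_mem (show ra (σ x) (σ y) (σ z) ∈ Γ from h.headL)
    have hl : Le (fun x => x) (ra (σ x) (σ y) (σ z) ::ₘ Γ, Δ)
        (ra (σ y) (σ x) (σ z) ::ₘ ra (σ x) (σ y) (σ z) ::ₘ Γ, Δ) := le_addL {_}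
    obtain ⟨m, hm⟩ := ih ((h.mono hl).consL (e := ra y x z) (Multiset.mem_cons_self _ _))
    exact ⟨_, .exch _ _ _ hm⟩
  | assoc x y z u v w hw fw _ ih =>
    intro σ c h
    refine goal_assoc h.headL h.tailL.headL fun a c' hl h1 h2 => ?_
    have h' := (h.mono hl).update a hw fw
    have f1 := fw.1 _ (Multiset.mem_cons_self _ _)
    have f2 := fw.1 _ (Multiset.mem_cons_of_mem (Multiset.mem_cons_self _ _))
    simp only [ra, labelsOf, List.mem_cons, List.not_mem_nil, or_false, not_or] at f1 f2
    refine ih ((h'.consL ?_).consL ?_)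
    · simpa [SatE, ra, Function.update, eq_comm (b := w), f1, f2] using h2
    · simpa [SatE, ra, Function.update, eq_comm (b := w), f1, f2] using h1
  | unit x _ ih =>
    rintro σ ⟨Γ, Δ⟩ h
    have hl : Le (fun x => x) (Γ, Δ) (ra (σ x) Label.eps (σ x) ::ₘ Γ, Δ) := le_addL {_}
    obtain ⟨m, hm⟩ := ih ((h.mono hl).consL (e := ra x Label.eps x)
      (by simp [SatE, ra, h.eps]))
    exact ⟨_, .unit _ hm⟩
  | assocC x y w hw fw _ ih =>
    intro σ c h
    refine goal_assoc h.headL h.headL fun a c' hl h1 h2 => ?_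
    have h' := (h.mono hl).update a hw fw
    have f1 := fw.1 _ (Multiset.mem_cons_self _ _)
    simp only [ra, labelsOf, List.mem_cons, List.not_mem_nil, or_false, not_or] at f1
    refine ih ((h'.consL ?_).consL ?_)
    · simpa [SatE, ra, Function.update, eq_comm (b := w), f1] using h2
    · simpa [SatE, ra, Function.update, eq_comm (b := w), f1] using h1
  | eq1 w w' hw _ ih =>
    intro σ c h
    have h0 : ra (σ Label.eps) (σ w) (σ w') ∈ c.1 := h.headL
    rw [h.eps] at h0
    refine goal_eq h0 fun τ c' hl he => ?_
    have h' := h.mono hl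
    refine ih ((h'.tailL.subst he).consL ?_)
    have h2 : ra (τ (σ Label.eps)) (τ (σ w)) (τ (σ w')) ∈ c'.1 := h'.headL
    rw [he] at h2
    exact h2
  | eq2 w w' hw _ ih =>
    intro σ c h
    have h0 : ra (σ Label.eps) (σ w') (σ w) ∈ c.1 := h.headL
    rw [h.eps] at h0
    refine goal_eq h0 fun τ c' hl he => ?_
    have h' := h.mono hl
    refine ih ((h'.tailL.subst he.symm).consL ?_)
    have h2 : ra (τ (σ Label.eps)) (τ (σ w')) (τ (σ w)) ∈ c'.1 := h'.headL
    rw [← he] at h2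
    exact h2
  | cut x A _ _ ih1 ih2 =>
    intro σ c h
    have h1 := h.sub (Multiset.subset_of_le (Multiset.le_add_right _ _))
      (Multiset.subset_of_le (Multiset.le_add_right _ _))
    have h2 := h.sub (Multiset.subset_of_le (Multiset.le_add_left _ _))
      (Multiset.subset_of_le (Multiset.le_add_left _ _))
    refine ih1 (h1.consR (dual A true fun τ c' hl hx => ?_))
    exact ih2 ((h2.mono hl).consL hx)

theorem sat_self (Γ : Multiset LElem) (Δ : Multiset LForm) :
    Sat (fun x => x) (Γ, Δ) Γ Δ where
  eps := rfl
  left e he := by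
    rcases e with ⟨x, y, z⟩ | ⟨x, A⟩
    · exact he
    · exact V_of_key (key A true) (cov_of_mem (s := true) he)
  right f hf := V_of_key (key f.2 false) (cov_of_mem (s := false) hf)

end CutElim

/-- Cut elimination for LS_BBI: any sequent derivable with the cut rule is
derivable without cut. -/
theorem lsbbi_cut_elimination {Γ : Multiset LElem} {Δ : Multiset LForm} {n : ℕ}
    (h : Deriv true Γ Δ n) :
    ∃ m : ℕ, Deriv false Γ Δ m :=
  CutElim.sound h (CutElim.sat_self Γ Δ)
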